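/- arXiv:1712.05310 — 6 statements merged into one kernel-verified Lean document; each statement's English description precedes it below -/
import Mathlib

section
/- If two pointed epistemic models M_s and N_{s'} are bisimilar, then they satisfy exactly the same formulas of L_BAPAL: for every φ ∈ L_BAPAL, M_s ⊨ φ iff N_{s'} ⊨ φ. -/
/-- Boolean (propositional) formulas over atoms `P`. -/
inductive PLForm (P : Type) : Type
  | atom : P → PLForm P
  | neg : PLForm P → PLForm P
  | and : PLForm P → PLForm P → PLForm P

/-- The language L_BAPAL over agents `A` and atoms `P`. -/
inductive Form (A P : Type) : Type
  | atom : P → Form A P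
  | neg : Form A P → Form A P
  | and : Form A P → Form A P → Form A P
  | know : A → Form A P → Form A P
  | ann : Form A P → Form A P → Form A P
  | box : Form A P → Form A P

def PLForm.toForm {A P : Type} : PLForm P → Form A P
  | .atom p => .atom p
  | .neg φ => .neg φ.toForm
  | .and φ ψ => .and φ.toForm ψ.toForm

structure Model (A P : Type) where
  S : Type
  rel : A → S → S → Prop
  val : P → S → Prop

/-- An epistemic model: each accessibility relation is an equivalence relation. -/
def Model.IsEpistemic {A P : Type} (M : Model A P) : Prop :=
  ∀ a : A, Equivalence (M.rel a)

/-- Restriction of a model to a subset of its states. -/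
def Model.restrict {A P : Type} (M : Model A P) (X : Set M.S) : Model A P where
  S := X
  rel a s t := M.rel a s.val t.val
  val p s := M.val p s.val

/-- Satisfaction of boolean formulas. -/
def SatPL {A P : Type} (M : Model A P) (s : M.S) : PLForm P → Prop
  | .atom p => M.val p s
  | .neg φ => ¬ SatPL M s φ
  | .and φ ψ => SatPL M s φ ∧ SatPL M s ψ

/-- BAPAL satisfaction. -/
def Sat {A P : Type} : (M : Model A P) → M.S → Form A P → Prop
  | M, s, .atom p => M.val p s
  | M, s, .neg φ => ¬ Sat M s φ
  | M, s, .and φ ψ => Sat M s φ ∧ Sat M s ψ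
  | M, s, .know a φ => ∀ t : M.S, M.rel a s t → Sat M t φ
  | M, s, .ann φ ψ => ∀ h : Sat M s φ, Sat (M.restrict {t | Sat M t φ}) ⟨s, h⟩ ψ
  | M, s, .box ψ => ∀ (φ₀ : PLForm P) (h : SatPL M s φ₀),
      Sat (M.restrict {t | SatPL M t φ₀}) ⟨s, h⟩ ψ

def Valid {A P : Type} (φ : Form A P) : Prop :=
  ∀ M : Model A P, M.IsEpistemic → ∀ s : M.S, Sat M s φ

def Form.imp {A P : Type} (φ ψ : Form A P) : Form A P := .neg (.and φ (.neg ψ))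
def Form.iff {A P : Type} (φ ψ : Form A P) : Form A P := .and (φ.imp ψ) (ψ.imp φ)
def Form.dia {A P : Type} (φ : Form A P) : Form A P := .neg (.box (.neg φ))
def Form.khat {A P : Type} (a : A) (φ : Form A P) : Form A P := .neg (.know a (.neg φ))
def Form.diaAnn {A P : Type} (φ ψ : Form A P) : Form A P := .neg (.ann φ (.neg ψ))

def Form.occurs {A P : Type} (q : P) : Form A P → Prop
  | .atom p => p = q
  | .neg φ => φ.occurs q
  | .and φ ψ => φ.occurs q ∨ ψ.occurs q
  | .know _ φ => φ.occurs q
  | .ann φ ψ => φ.occurs q ∨ ψ.occurs q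
  | .box φ => φ.occurs q

def Form.mapAtoms {A P Q : Type} (f : P → Q) : Form A P → Form A Q
  | .atom p => .atom (f p)
  | .neg φ => .neg (φ.mapAtoms f)
  | .and φ ψ => .and (φ.mapAtoms f) (ψ.mapAtoms f)
  | .know a φ => .know a (φ.mapAtoms f)
  | .ann φ ψ => .ann (φ.mapAtoms f) (ψ.mapAtoms f)
  | .box φ => .box (φ.mapAtoms f)
/-- `R` is a bisimulation between models `M` and `N`. -/
def IsBisim {A P : Type} (M N : Model A P) (R : M.S → N.S → Prop) : Prop :=
  (∃ s t, R s t) ∧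
  ∀ s t, R s t →
    (∀ p : P, M.val p s ↔ N.val p t) ∧
    (∀ (a : A) (s' : M.S), M.rel a s s' → ∃ t' : N.S, N.rel a t t' ∧ R s' t') ∧
    (∀ (a : A) (t' : N.S), N.rel a t t' → ∃ s' : M.S, M.rel a s s' ∧ R s' t')

/-- `M_s` and `N_t` are bisimilar. -/
def Bisimilar {A P : Type} (M N : Model A P) (s : M.S) (t : N.S) : Prop :=
  ∃ R, IsBisim M N R ∧ R s t

/-- Restricting both models to sets that a bisimulation does not separate preserves bisimilarity. -/
theorem IsBisim.bisimilar_restrict {A P : Type} {M N : Model A P} {R : M.S → N.S → Prop}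
    (hR : IsBisim M N R) {X : Set M.S} {Y : Set N.S}
    (hXY : ∀ s t, R s t → (s ∈ X ↔ t ∈ Y)) {s : M.S} {t : N.S} (hst : R s t)
    (hs : s ∈ X) (ht : t ∈ Y) :
    Bisimilar (M.restrict X) (N.restrict Y) ⟨s, hs⟩ ⟨t, ht⟩ := by
  refine ⟨fun x y => R x.val y.val, ⟨⟨⟨s, hs⟩, ⟨t, ht⟩, hst⟩, ?_⟩, hst⟩
  rintro ⟨x, hx⟩ ⟨y, hy⟩ hxy
  obtain ⟨atoms, forth, back⟩ := hR.2 x y hxy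
  refine ⟨atoms, ?_, ?_⟩
  · rintro a ⟨x', hx'⟩ hrel
    obtain ⟨y', hy', hR'⟩ := forth a x' hrel
    exact ⟨⟨y', (hXY _ _ hR').1 hx'⟩, hy', hR'⟩
  · rintro a ⟨y', hy'⟩ hrel
    obtain ⟨x', hx', hR'⟩ := back a y' hrel
    exact ⟨⟨x', (hXY _ _ hR').2 hy'⟩, hx', hR'⟩

theorem IsBisim.satPL_iff {A P : Type} {M N : Model A P} {R : M.S → N.S → Prop}
    (hR : IsBisim M N R) {s : M.S} {t : N.S} (hst : R s t) (φ : PLForm P) :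
    SatPL M s φ ↔ SatPL N t φ := by
  induction φ with
  | atom p => exact (hR.2 s t hst).1 p
  | neg φ ih => exact not_congr ih
  | and φ ψ ihφ ihψ => exact and_congr ihφ ihψ

theorem Bisimilar.sat_iff {A P : Type} (φ : Form A P) {M N : Model A P} {s : M.S} {t : N.S}
    (h : Bisimilar M N s t) : Sat M s φ ↔ Sat N t φ := by
  induction φ generalizing M N with
  | atom p =>
    obtain ⟨R, hR, hst⟩ := h
    simpa only [Sat] using (hR.2 s t hst).1 p
  | neg φ ih => simpa only [Sat] using not_congr (ih h)
  | and φ ψ ihφ ihψ => simpa only [Sat] using and_congr (ihφ h) (ihψ h)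
  | know a φ ih =>
    obtain ⟨R, hR, hst⟩ := h
    obtain ⟨-, forth, back⟩ := hR.2 s t hst
    simp only [Sat]
    constructor
    · intro hφ t' ht'
      obtain ⟨s', hs', hR'⟩ := back a t' ht'
      exact (ih ⟨R, hR, hR'⟩).1 (hφ s' hs')
    · intro hφ s' hs'
      obtain ⟨t', ht', hR'⟩ := forth a s' hs'
      exact (ih ⟨R, hR, hR'⟩).2 (hφ t' ht')
  | ann φ ψ ihφ ihψ =>
    obtain ⟨R, hR, hst⟩ := h
    have hφ : ∀ x y, R x y → (Sat M x φ ↔ Sat N y φ) := fun x y hxy => ihφ ⟨R, hR, hxy⟩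
    simp only [Sat]
    have h_iff := fun hs ht => ihψ (hR.bisimilar_restrict hφ hst hs ht)
    exact ⟨fun hψ ht => (h_iff ((hφ s t hst).2 ht) ht).1 (hψ _),
      fun hψ hs => (h_iff hs ((hφ s t hst).1 hs)).2 (hψ _)⟩
  | box ψ ih =>
    obtain ⟨R, hR, hst⟩ := h
    simp only [Sat]
    refine forall_congr' fun φ₀ => ?_
    have hφ : ∀ x y, R x y → (SatPL M x φ₀ ↔ SatPL N y φ₀) := fun x y hxy => hR.satPL_iff hxy φ₀
    have h_iff := fun hs ht => ih (hR.bisimilar_restrict hφ hst hs ht)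
    exact ⟨fun hψ ht => (h_iff ((hφ s t hst).2 ht) ht).1 (hψ _),
      fun hψ hs => (h_iff hs ((hφ s t hst).1 hs)).2 (hψ _)⟩

/-- bisimilar pointed epistemic models satisfy the same L_BAPAL formulas. -/
theorem bisimulation_preserves_BAPAL {A : Type} [Countable A]
    (M N : Model A ℕ) (hM : M.IsEpistemic) (hN : N.IsEpistemic)
    (s : M.S) (t : N.S) (h : Bisimilar M N s t) :
    ∀ φ : Form A ℕ, Sat M s φ ↔ Sat N t φ :=
  fun φ => h.sat_iff φ
end

section
/- For every φ ∈ L_BAPAL, the McKinsey-type formula □◇φ → ◇□φ is valid with respect to the L_BAPAL semantics, where ◇χ abbreviates ¬□¬χ. -/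
/-- The truth value of a formula in a reflexive model whose states all have valuation `v`. -/
def Form.eval {A P : Type} (v : P → Prop) : Form A P → Prop
  | .atom p => v p
  | .neg φ => ¬ φ.eval v
  | .and φ ψ => φ.eval v ∧ ψ.eval v
  | .know _ φ => φ.eval v
  | .ann φ ψ => φ.eval v → ψ.eval v
  | .box φ => φ.eval v

/-- If the atoms of `φ` are constant over a reflexive model, then `φ` has the same value at every
state, and this value only depends on the valuation. -/
theorem sat_iff_eval {A P : Type} [Nonempty P] (v : P → Prop) (φ : Form A P) (M : Model A P)
    (hrefl : ∀ a s, M.rel a s s) (hv : ∀ p, φ.occurs p → ∀ t, M.val p t ↔ v p) (s : M.S) :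
    Sat M s φ ↔ φ.eval v := by
  induction φ generalizing M with
  | atom p => simpa only [Sat, Form.eval] using hv p rfl s
  | neg φ ih => simp only [Sat, Form.eval, ih M hrefl hv s]
  | and φ ψ ihφ ihψ =>
    simp only [Sat, Form.eval, ihφ M hrefl (fun p hp => hv p (.inl hp)) s,
      ihψ M hrefl (fun p hp => hv p (.inr hp)) s]
  | know a φ ih =>
    simp only [Sat, Form.eval]
    exact ⟨fun h => (ih M hrefl hv s).1 (h s (hrefl a s)), fun h t _ => (ih M hrefl hv t).2 h⟩
  | ann φ ψ ihφ ihψ =>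
    have hφ := ihφ M hrefl (fun p hp => hv p (.inl hp)) s
    have hψ := ihψ (M.restrict {t | Sat M t φ}) (fun a t => hrefl a t.val)
      (fun p hp t => hv p (.inr hp) t.val)
    simp only [Sat, Form.eval]
    exact ⟨fun h hs => (hψ _).1 (h (hφ.2 hs)), fun h hs => (hψ _).2 (h (hφ.1 hs))⟩
  | box φ ih =>
    have hφ (φ₀ : PLForm P) := ih (M.restrict {t | SatPL M t φ₀}) (fun a t => hrefl a t.val)
      (fun p hp t => hv p hp t.val)
    simp only [Sat, Form.eval]
    refine ⟨fun h => ?_, fun h φ₀ hs => (hφ φ₀ _).2 h⟩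
    obtain ⟨p⟩ := ‹Nonempty P›
    have htaut : SatPL M s (.neg (.and (.atom p) (.neg (.atom p)))) := by simp [SatPL]
    exact (hφ _ _).1 (h _ htaut)

/-- A boolean formula true at `s` that fixes the values of all atoms occurring in `φ`. -/
theorem exists_boolean_fixing_atoms {A P : Type} (φ : Form A P) (M : Model A P) (s : M.S) :
    ∃ δ : PLForm P, SatPL M s δ ∧
      ∀ t, SatPL M t δ → ∀ p, φ.occurs p → (M.val p t ↔ M.val p s) := by
  have hconj {φ ψ : Form A P}
      (hφ : ∃ δ : PLForm P, SatPL M s δ ∧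
        ∀ t, SatPL M t δ → ∀ p, φ.occurs p → (M.val p t ↔ M.val p s))
      (hψ : ∃ δ : PLForm P, SatPL M s δ ∧
        ∀ t, SatPL M t δ → ∀ p, ψ.occurs p → (M.val p t ↔ M.val p s)) :
      ∃ δ : PLForm P, SatPL M s δ ∧ ∀ t, SatPL M t δ → ∀ p, φ.occurs p ∨ ψ.occurs p →
        (M.val p t ↔ M.val p s) := by
    obtain ⟨δ, hδ, hδ'⟩ := hφ
    obtain ⟨ε, hε, hε'⟩ := hψ
    exact ⟨.and δ ε, ⟨hδ, hε⟩, fun t ht p hp => hp.elim (hδ' t ht.1 p) (hε' t ht.2 p)⟩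
  induction φ with
  | atom q =>
    by_cases hq : M.val q s
    · refine ⟨.atom q, hq, ?_⟩
      rintro t ht _ rfl
      exact iff_of_true ht hq
    · refine ⟨.neg (.atom q), hq, ?_⟩
      rintro t ht _ rfl
      exact iff_of_false ht hq
  | neg φ ih => exact ih
  | and φ ψ ihφ ihψ => exact hconj ihφ ihψ
  | know a φ ih => exact ih
  | ann φ ψ ihφ ihψ => exact hconj ihφ ihψ
  | box φ ih => exact ih

/-- the McKinsey-type formula `□◇φ → ◇□φ` is valid, where `◇χ := ¬□¬χ`. -/
theorem mckinsey_valid {A : Type} [Countable A] (φ : Form A ℕ) :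
    Valid (Form.imp (.box (Form.dia φ)) (Form.dia (.box φ))) := by
  intro M hM s
  obtain ⟨δ, hs, hδ⟩ := exists_boolean_fixing_atoms φ M s
  have key (χ : Form A ℕ) (hχ : ∀ p, χ.occurs p → φ.occurs p) :=
    sat_iff_eval (fun p => M.val p s) χ (M.restrict {t | SatPL M t δ})
      (fun a t => (hM a).refl t.val) (fun p hp t => hδ t.val t.property p (hχ p hp)) ⟨s, hs⟩
  rintro ⟨hbox, hdia⟩
  refine hdia fun hneg => hneg δ hs ?_
  have heval := (key (Form.dia φ) fun _ hp => hp).1 (hbox δ hs)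
  exact (key (.box φ) fun _ hp => hp).2 (not_not.1 heval)
end

section
/- For every formula ψ ∈ L_BAPAL(P̈), every epistemic model M for atoms P and every state s of M: M̈_s ⊨ ψ iff M_s ⊨ tr(ψ). In particular, for ψ ∈ L_BAPAL(P), M̈_s ⊨ ψ iff M_s ⊨ ψ. -/
/-- The extended atom set `P̈ = P ∪ {p_{φ₀} : φ₀ ∈ L_PL(P)}`: the right summand
provides a fresh atom `p_{φ₀}` for every boolean `φ₀` over `P`. -/
abbrev DDotAtoms (P : Type) : Type := P ⊕ PLForm P

/-- The boolean closure `M̈` of a model `M` for atoms `P`: same states and relations,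
and the fresh atom `p_{φ₀}` is assigned the value `⟦φ₀⟧_M`. -/
def Model.ddot {A P : Type} (M : Model A P) : Model A (DDotAtoms P) where
  S := M.S
  rel := M.rel
  val q s := match q with
    | .inl p => M.val p s
    | .inr φ₀ => SatPL M s φ₀

/-- The translation `tr : L_BAPAL(P̈) → L_BAPAL(P)`: it replaces every fresh atom
`p_{φ₀}` by the boolean `φ₀` and commutes with all other constructs. -/
def tr {A P : Type} : Form A (DDotAtoms P) → Form A P
  | .atom (.inl p) => .atom p
  | .atom (.inr φ₀) => φ₀.toForm
  | .neg φ => .neg (tr φ)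
  | .and φ ψ => .and (tr φ) (tr ψ)
  | .know a φ => .know a (tr φ)
  | .ann φ ψ => .ann (tr φ) (tr ψ)
  | .box φ => .box (tr φ)

theorem satPL_restrict {A P : Type} (M : Model A P) (X : Set M.S) (s : X) (φ : PLForm P) :
    SatPL (M.restrict X) s φ ↔ SatPL M s.val φ := by
  induction φ with
  | atom p => rfl
  | neg φ ih => exact not_congr ih
  | and φ ψ ihφ ihψ => exact and_congr ihφ ihψ

theorem sat_toForm {A P : Type} (M : Model A P) (s : M.S) (φ : PLForm P) :
    Sat M s φ.toForm ↔ SatPL M s φ := by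
  induction φ with
  | atom p => rfl
  | neg φ ih => exact not_congr ih
  | and φ ψ ihφ ihψ => exact and_congr ihφ ihψ

theorem sat_congr_val {A P S : Type} (rel : A → S → S → Prop) {v w : P → S → Prop}
    (h : ∀ p s, v p s ↔ w p s) (s : S) (φ : Form A P) :
    Sat ⟨S, rel, v⟩ s φ ↔ Sat ⟨S, rel, w⟩ s φ := by
  obtain rfl : v = w := funext fun p => funext fun s => propext (h p s)
  rfl

theorem sat_restrict_congr {A P : Type} (M : Model A P) {X Y : Set M.S}
    (h : ∀ t, t ∈ X ↔ t ∈ Y) (s : M.S) (hX : s ∈ X) (hY : s ∈ Y) (φ : Form A P) :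
    Sat (M.restrict X) ⟨s, hX⟩ φ ↔ Sat (M.restrict Y) ⟨s, hY⟩ φ := by
  obtain rfl : X = Y := Set.ext h
  rfl

/-- Boolean closure commutes with restriction, up to satisfaction. -/
theorem sat_ddot_restrict {A P : Type} (M : Model A P) (X : Set M.S) (s : X)
    (φ : Form A (DDotAtoms P)) :
    Sat (M.ddot.restrict X) s φ ↔ Sat (M.restrict X).ddot s φ := by
  refine sat_congr_val (fun a (s t : X) => M.rel a s.val t.val) ?_ s φ
  rintro (p | φ₀) t
  · rfl
  · exact (satPL_restrict M X t φ₀).symm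

/-- The translation `tr` on boolean formulas. -/
def PLForm.tr {P : Type} : PLForm (DDotAtoms P) → PLForm P
  | .atom (.inl p) => .atom p
  | .atom (.inr φ₀) => φ₀
  | .neg φ => .neg φ.tr
  | .and φ ψ => .and φ.tr ψ.tr

theorem satPL_ddot {A P : Type} (M : Model A P) (s : M.S) (φ : PLForm (DDotAtoms P)) :
    SatPL M.ddot s φ ↔ SatPL M s φ.tr := by
  induction φ with
  | atom q => cases q <;> rfl
  | neg φ ih => exact not_congr ih
  | and φ ψ ihφ ihψ => exact and_congr ihφ ihψ

theorem sat_ddot {A P : Type} (ψ : Form A (DDotAtoms P)) (M : Model A P) (s : M.S) :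
    Sat M.ddot s ψ ↔ Sat M s (tr ψ) := by
  induction ψ generalizing M with
  | atom q =>
    cases q with
    | inl p => rfl
    | inr φ₀ => exact (sat_toForm M s φ₀).symm
  | neg φ ih => exact not_congr (ih M s)
  | and φ ψ ihφ ihψ => exact and_congr (ihφ M s) (ihψ M s)
  | know a φ ih => exact forall_congr' fun t => imp_congr_right fun _ => ih M t
  | ann φ ψ ihφ ihψ =>
    have key (h : Sat M.ddot s φ) (h' : Sat M s (tr φ)) :
        Sat (M.ddot.restrict {t | Sat M.ddot t φ}) ⟨s, h⟩ ψ ↔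
          Sat (M.restrict {t | Sat M t (tr φ)}) ⟨s, h'⟩ (tr ψ) :=
      (sat_restrict_congr M.ddot (ihφ M) s h h' ψ).trans
        ((sat_ddot_restrict M _ _ ψ).trans (ihψ _ _))
    exact ⟨fun H h => (key ((ihφ M s).2 h) h).1 (H _), fun H h => (key h ((ihφ M s).1 h)).2 (H _)⟩
  | box ψ ih =>
    constructor
    · intro H φ₀ h
      exact (ih _ _).1 ((sat_ddot_restrict M _ _ ψ).1 (H (.atom (.inr φ₀)) h))
    · intro H φ₀ h
      have h' := (satPL_ddot M s φ₀).1 h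
      exact (sat_restrict_congr M.ddot (fun t => satPL_ddot M t φ₀) s h h' ψ).2
        ((sat_ddot_restrict M _ _ ψ).2 ((ih _ _).2 (H φ₀.tr h')))

theorem tr_mapAtoms_inl {A P : Type} (ψ : Form A P) : tr (ψ.mapAtoms Sum.inl) = ψ := by
  induction ψ <;> simp_all [Form.mapAtoms, tr]

/-- for every `ψ ∈ L_BAPAL(P̈)`, `M̈_s ⊨ ψ` iff `M_s ⊨ tr(ψ)`; in
particular, for `ψ ∈ L_BAPAL(P)`, `M̈_s ⊨ ψ` iff `M_s ⊨ ψ`. -/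
theorem ddot_tr_truth {A : Type} [Countable A]
    (M : Model A ℕ) (hM : M.IsEpistemic) (s : M.S) :
    (∀ ψ : Form A (DDotAtoms ℕ), Sat M.ddot s ψ ↔ Sat M s (tr ψ)) ∧
    (∀ ψ : Form A ℕ, Sat M.ddot s (ψ.mapAtoms Sum.inl) ↔ Sat M s ψ) := by
  refine ⟨fun ψ => sat_ddot ψ M s, fun ψ => ?_⟩
  rw [sat_ddot, tr_mapAtoms_inl]
end

section
/- Assume there are at least two distinct agents a, b ∈ A. Then L_BAPAL (with its semantics) is strictly more expressive than the epistemic language L_EL: every L_EL formula is an L_BAPAL formula, but there is an L_BAPAL formula, namely ◇(K_a p ∧ ¬K_b K_a p) where ◇χ := ¬□¬χ, that is not semantically equivalent to any L_EL formula. -/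
/-- The epistemic fragment L_EL of L_BAPAL: no announcements and no quantifiers. -/
inductive IsEL {A P : Type} : Form A P → Prop
  | atom (p : P) : IsEL (.atom p)
  | neg {φ} : IsEL φ → IsEL (.neg φ)
  | and {φ ψ} : IsEL φ → IsEL ψ → IsEL (.and φ ψ)
  | know {φ} (a : A) : IsEL φ → IsEL (.know a φ)

/-- Only finitely many atoms occur in a formula, so all large enough atoms are fresh. -/
theorem Form.exists_forall_ge_not_occurs {A : Type} (φ : Form A ℕ) :
    ∃ n, ∀ q ≥ n, ¬ φ.occurs q := by
  induction φ with
  | atom p => exact ⟨p + 1, fun q hq h => by simp only [Form.occurs] at h; omega⟩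
  | neg φ ih => exact ih
  | know c φ ih => exact ih
  | box φ ih => exact ih
  | and φ ψ ihφ ihψ =>
    obtain ⟨m, hm⟩ := ihφ
    obtain ⟨n, hn⟩ := ihψ
    exact ⟨max m n, fun q hq h => h.elim (hm q (le_of_max_le_left hq))
      (hn q (le_of_max_le_right hq))⟩
  | ann φ ψ ihφ ihψ =>
    obtain ⟨m, hm⟩ := ihφ
    obtain ⟨n, hn⟩ := ihψ
    exact ⟨max m n, fun q hq h => h.elim (hm q (le_of_max_le_left hq))
      (hn q (le_of_max_le_right hq))⟩

/-- The model with a `p`-state `true` and a `¬p`-state `false`, which agent `a` cannot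
distinguish and every other agent can. -/
def ignorantModel {A : Type} (a : A) (p : ℕ) : Model A ℕ where
  S := Bool
  rel c x y := c = a ∨ x = y
  val n x := n = p ∧ x = true

/-- Two copies of `ignorantModel a p`, told apart by the atom `q`. Agent `a` knows which copy is
actual, and every other agent only knows the value of `p`. -/
def doubledModel {A : Type} (a : A) (p q : ℕ) : Model A ℕ where
  S := Bool × Bool
  rel c x y := (c = a → x.2 = y.2) ∧ (c ≠ a → x.1 = y.1)
  val n x := n = p ∧ x.1 = true ∨ n = q ∧ x.2 = true

theorem ignorantModel_isEpistemic {A : Type} (a : A) (p : ℕ) :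
    (ignorantModel a p).IsEpistemic := fun _ =>
  ⟨fun _ => Or.inr rfl, Or.imp_right Eq.symm, by
    rintro x y z (h | rfl) h'
    · exact Or.inl h
    · exact h'⟩

theorem doubledModel_isEpistemic {A : Type} (a : A) (p q : ℕ) :
    (doubledModel a p q).IsEpistemic := fun _ =>
  ⟨fun _ => ⟨fun _ => rfl, fun _ => rfl⟩,
    fun h => ⟨fun hc => (h.1 hc).symm, fun hc => (h.2 hc).symm⟩,
    fun h h' => ⟨fun hc => (h.1 hc).trans (h'.1 hc), fun hc => (h.2 hc).trans (h'.2 hc)⟩⟩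

/-- The first projection is a bisimulation up to the atom `q`. -/
theorem sat_doubledModel_iff {A : Type} {a : A} {p q : ℕ} {ψ : Form A ℕ} (hψ : IsEL ψ)
    (hq : ¬ ψ.occurs q) (x : Bool × Bool) :
    Sat (doubledModel a p q) x ψ ↔ Sat (ignorantModel a p) x.1 ψ := by
  induction hψ generalizing x with
  | atom n =>
    have hn : n ≠ q := hq
    simp [Sat, doubledModel, ignorantModel, hn]
  | neg _ ih => exact not_congr (ih hq x)
  | and _ _ ihφ ihψ =>
    exact and_congr (ihφ (fun h => hq (Or.inl h)) x) (ihψ (fun h => hq (Or.inr h)) x)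
  | know c _ ih =>
    constructor
    · intro h y hxy
      by_cases hc : c = a
      · exact (ih hq (y, x.2)).1 (h (y, x.2) ⟨fun _ => rfl, fun h' => absurd hc h'⟩)
      · obtain rfl : x.1 = y := hxy.resolve_left hc
        exact (ih hq x).1 (h x ⟨fun _ => rfl, fun _ => rfl⟩)
    · intro h y hxy
      refine (ih hq y).2 (h y.1 ?_)
      by_cases hc : c = a
      · exact Or.inl hc
      · exact Or.inr (hxy.2 hc)

theorem not_sat_ignorantModel_dia {A : Type} {a b : A} (p : ℕ) (s : Bool) :
    ¬ Sat (ignorantModel a p) s (Form.dia (.and (.know a (.atom p))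
      (.neg (.know b (.know a (.atom p)))))) := by
  refine not_not_intro fun φ₀ h => ?_
  rintro ⟨hK, hnK⟩
  exact hnK fun t _ u _ => hK u (Or.inl rfl)

/-- Announcing `p ∨ q` removes the `¬p`-state of the copy without `q` only. -/
theorem sat_doubledModel_dia {A : Type} {a b : A} (hab : a ≠ b) {p q : ℕ} (hpq : p ≠ q) :
    Sat (doubledModel a p q) (true, false) (Form.dia (.and (.know a (.atom p))
      (.neg (.know b (.know a (.atom p)))))) := by
  let φ₀ : PLForm ℕ := .neg (.and (.neg (.atom p)) (.neg (.atom q)))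
  have hφ₀ (x : Bool × Bool) :
      SatPL (doubledModel a p q) x φ₀ ↔ x.1 = true ∨ x.2 = true := by
    simp only [φ₀, SatPL, doubledModel, hpq, hpq.symm]
    tauto
  intro hbox
  refine hbox φ₀ ((hφ₀ _).2 (Or.inl rfl)) ⟨?_, ?_⟩
  · rintro ⟨⟨x, i⟩, hx⟩ hrel
    obtain rfl : false = i := hrel.1 rfl
    exact Or.inl ⟨rfl, ((hφ₀ _).1 hx).resolve_right Bool.false_ne_true⟩
  · intro hK
    have h := hK ⟨(true, true), (hφ₀ _).2 (Or.inl rfl)⟩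
      ⟨fun h => absurd h hab.symm, fun _ => rfl⟩
      ⟨(false, true), (hφ₀ _).2 (Or.inr rfl)⟩ ⟨fun _ => rfl, fun h => absurd rfl h⟩
    rcases h with ⟨_, h⟩ | ⟨h, _⟩
    · exact Bool.false_ne_true h
    · exact hpq h

/-- L_BAPAL is strictly more expressive than L_EL: every L_EL formula
has an equivalent L_BAPAL formula (it is one), but the L_BAPAL formula
`◇(K_a p ∧ ¬K_b K_a p)` (where `◇χ := ¬□¬χ`) is not equivalent to any L_EL formula,
given two distinct agents `a ≠ b`. -/
theorem bapal_strictly_more_expressive_than_el {A : Type} [Countable A]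
    (a b : A) (hab : a ≠ b) (p : ℕ) :
    (∀ ψ : Form A ℕ, IsEL ψ →
      ∃ χ : Form A ℕ, ∀ M : Model A ℕ, M.IsEpistemic → ∀ s : M.S,
        (Sat M s χ ↔ Sat M s ψ)) ∧
    ¬ ∃ ψ : Form A ℕ, IsEL ψ ∧
        ∀ M : Model A ℕ, M.IsEpistemic → ∀ s : M.S,
          (Sat M s ψ ↔
            Sat M s (Form.dia (.and (.know a (.atom p))
              (.neg (.know b (.know a (.atom p))))))) := by
  refine ⟨fun ψ _ => ⟨ψ, fun _ _ _ => Iff.rfl⟩, ?_⟩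
  rintro ⟨ψ, hψ, hequiv⟩
  obtain ⟨n, hn⟩ := ψ.exists_forall_ge_not_occurs
  let q := max n (p + 1)
  have hpq : p ≠ q := by omega
  have hsat := (hequiv _ (doubledModel_isEpistemic a p q) (true, false)).2
    (sat_doubledModel_dia hab hpq)
  rw [sat_doubledModel_iff hψ (hn q (le_max_left _ _))] at hsat
  exact not_sat_ignorantModel_dia p true ((hequiv _ (ignorantModel_isEpistemic a p) true).1 hsat)
end

section
/- Assume there are at least two distinct agents a, b ∈ A. Then L_BAPAL is not at least as expressive as APAL: there is no formula ψ ∈ L_BAPAL (interpreted with the BAPAL semantics of □) that is true at exactly the same pointed epistemic models as the formula ◇(K_a p ∧ ¬K_b K_a p) interpreted with the APAL semantics of □, where ◇χ := ¬□¬χ. -/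
/-- The epistemic language L_EL (atoms, negation, conjunction, knowledge). -/
inductive ELForm (A P : Type) : Type
  | atom : P → ELForm A P
  | neg : ELForm A P → ELForm A P
  | and : ELForm A P → ELForm A P → ELForm A P
  | know : A → ELForm A P → ELForm A P

/-- Satisfaction of epistemic formulas. -/
def SatEL {A P : Type} (M : Model A P) (s : M.S) : ELForm A P → Prop
  | .atom p => M.val p s
  | .neg φ => ¬ SatEL M s φ
  | .and φ ψ => SatEL M s φ ∧ SatEL M s ψ
  | .know a φ => ∀ t : M.S, M.rel a s t → SatEL M t φ

/-- APAL satisfaction: as BAPAL, except that `□ψ` quantifies over announcements of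
arbitrary epistemic (equivalently, `□`-free) formulas. -/
def SatAPAL {A P : Type} : (M : Model A P) → M.S → Form A P → Prop
  | M, s, .atom p => M.val p s
  | M, s, .neg φ => ¬ SatAPAL M s φ
  | M, s, .and φ ψ => SatAPAL M s φ ∧ SatAPAL M s ψ
  | M, s, .know a φ => ∀ t : M.S, M.rel a s t → SatAPAL M t φ
  | M, s, .ann φ ψ => ∀ h : SatAPAL M s φ, SatAPAL (M.restrict {t | SatAPAL M t φ}) ⟨s, h⟩ ψ
  | M, s, .box ψ => ∀ (χ : ELForm A P) (h : SatEL M s χ),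
      SatAPAL (M.restrict {t | SatEL M t χ}) ⟨s, h⟩ ψ

/-- The number of rounds of the bisimulation game that suffices to preserve a formula. -/
def Form.depth {A P : Type} : Form A P → ℕ
  | .atom _ => 0
  | .neg φ => φ.depth
  | .and φ ψ => max φ.depth ψ.depth
  | .know _ φ => φ.depth + 1
  | .ann φ ψ => ψ.depth + φ.depth
  | .box φ => φ.depth

/-- Bounded bisimilarity of pointed models, with respect to all atoms. -/
def BoundedBisim {A P : Type} (M N : Model A P) : ℕ → M.S → N.S → Prop
  | 0, s, t => ∀ q, M.val q s ↔ N.val q t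
  | k + 1, s, t => (∀ q, M.val q s ↔ N.val q t) ∧
      ∀ c, (∀ s', M.rel c s s' → ∃ t', N.rel c t t' ∧ BoundedBisim M N k s' t') ∧
        (∀ t', N.rel c t t' → ∃ s', M.rel c s s' ∧ BoundedBisim M N k s' t')

namespace BoundedBisim

variable {A P : Type} {M N : Model A P}

theorem val_iff {k : ℕ} {s : M.S} {t : N.S} (h : BoundedBisim M N k s t) (q : P) :
    M.val q s ↔ N.val q t := by
  cases k with
  | zero => exact h q
  | succ k => exact h.1 q

theorem of_succ {k : ℕ} {s : M.S} {t : N.S} (h : BoundedBisim M N (k + 1) s t) :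
    BoundedBisim M N k s t := by
  induction k generalizing s t with
  | zero => exact h.1
  | succ k ih =>
    refine ⟨h.1, fun c => ⟨fun s' hs => ?_, fun t' ht => ?_⟩⟩
    · obtain ⟨t', ht, hb⟩ := (h.2 c).1 s' hs
      exact ⟨t', ht, ih hb⟩
    · obtain ⟨s', hs, hb⟩ := (h.2 c).2 t' ht
      exact ⟨s', hs, ih hb⟩

theorem mono {k l : ℕ} (hkl : k ≤ l) {s : M.S} {t : N.S} (h : BoundedBisim M N l s t) :
    BoundedBisim M N k s t := by
  induction hkl with
  | refl => exact h
  | step _ ih => exact ih h.of_succ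

theorem restrict {X : Set M.S} {Y : Set N.S} {j : ℕ}
    (hXY : ∀ u v, BoundedBisim M N j u v → (u ∈ X ↔ v ∈ Y)) {k : ℕ} {s : X} {t : Y}
    (h : BoundedBisim M N (k + j) s.val t.val) :
    BoundedBisim (M.restrict X) (N.restrict Y) k s t := by
  induction k generalizing s t with
  | zero => exact h.val_iff
  | succ k ih =>
    rw [Nat.add_right_comm] at h
    refine ⟨h.1, fun c => ⟨fun s' hs => ?_, fun t' ht => ?_⟩⟩
    · obtain ⟨t', ht, hb⟩ := (h.2 c).1 s'.val hs
      exact ⟨⟨t', (hXY _ _ (hb.mono (Nat.le_add_left j k))).1 s'.property⟩, ht, ih hb⟩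
    · obtain ⟨s', hs, hb⟩ := (h.2 c).2 t'.val ht
      exact ⟨⟨s', (hXY _ _ (hb.mono (Nat.le_add_left j k))).2 t'.property⟩, hs, ih hb⟩

theorem satPL_iff {k : ℕ} {s : M.S} {t : N.S} (h : BoundedBisim M N k s t) (φ : PLForm P) :
    SatPL M s φ ↔ SatPL N t φ := by
  induction φ with
  | atom q => exact h.val_iff q
  | neg φ ih => exact not_congr ih
  | and φ ψ ihφ ihψ => exact and_congr ihφ ihψ

theorem sat_iff (ψ : Form A P) {M N : Model A P} {s : M.S} {t : N.S}
    (h : BoundedBisim M N ψ.depth s t) : Sat M s ψ ↔ Sat N t ψ := by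
  induction ψ generalizing M N with
  | atom q => simpa only [Sat] using h.val_iff q
  | neg φ ih => simpa only [Sat] using not_congr (ih h)
  | and φ ψ ihφ ihψ =>
    simpa only [Sat] using
      and_congr (ihφ (h.mono (le_max_left _ _))) (ihψ (h.mono (le_max_right _ _)))
  | know c φ ih =>
    simp only [Sat]
    constructor
    · intro hs t' ht
      obtain ⟨s', hs', hb⟩ := (h.2 c).2 t' ht
      exact (ih hb).1 (hs s' hs')
    · intro ht s' hs
      obtain ⟨t', ht', hb⟩ := (h.2 c).1 s' hs
      exact (ih hb).2 (ht t' ht')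
  | ann φ ψ ihφ ihψ =>
    have hst := ihφ (h.mono (Nat.le_add_left _ _))
    have hψ : ∀ hs ht, Sat (M.restrict {u | Sat M u φ}) ⟨s, hs⟩ ψ ↔
        Sat (N.restrict {v | Sat N v φ}) ⟨t, ht⟩ ψ :=
      fun _ _ => ihψ (restrict (j := φ.depth) (fun _ _ huv => ihφ huv) h)
    simp only [Sat]
    exact ⟨fun H ht => (hψ (hst.2 ht) ht).1 (H _), fun H hs => (hψ hs (hst.1 hs)).2 (H _)⟩
  | box ψ ih =>
    have hψ : ∀ φ₀ hs ht, Sat (M.restrict {u | SatPL M u φ₀}) ⟨s, hs⟩ ψ ↔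
        Sat (N.restrict {v | SatPL N v φ₀}) ⟨t, ht⟩ ψ :=
      fun φ₀ _ _ => ih (restrict (j := 0) (fun _ _ huv => huv.satPL_iff φ₀) h)
    simp only [Sat]
    exact ⟨fun H φ₀ ht => (hψ φ₀ ((h.satPL_iff φ₀).2 ht) ht).1 (H φ₀ _),
      fun H φ₀ hs => (hψ φ₀ hs ((h.satPL_iff φ₀).1 hs)).2 (H φ₀ _)⟩

end BoundedBisim

/-- The integers as a chain whose edges belong alternately to the agents `a` and `b`;
the atom `p` holds on `X`, and all other atoms are false. -/
abbrev chain {A P : Type} (a b : A) (p : P) (X : Set ℤ) : Model A P where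
  S := ℤ
  rel c x y := (c = a → (x + 1) / 2 = (y + 1) / 2) ∧ (c = b → x / 2 = y / 2) ∧
    (c ≠ a → c ≠ b → x = y)
  val q x := q = p ∧ x ∈ X

section Chain

variable {A P : Type} {a b : A} {p : P}

theorem chain_isEpistemic {X : Set ℤ} : (chain a b p X).IsEpistemic := fun _ =>
  { refl := fun _ => ⟨fun _ => rfl, fun _ => rfl, fun _ _ => rfl⟩
    symm := fun h => ⟨fun h₁ => (h.1 h₁).symm, fun h₁ => (h.2.1 h₁).symm,
      fun h₁ h₂ => (h.2.2 h₁ h₂).symm⟩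
    trans := fun h h' => ⟨fun h₁ => (h.1 h₁).trans (h'.1 h₁),
      fun h₁ => (h.2.1 h₁).trans (h'.2.1 h₁),
      fun h₁ h₂ => (h.2.2 h₁ h₂).trans (h'.2.2 h₁ h₂)⟩ }

theorem chain_rel_left (hab : a ≠ b) {X : Set ℤ} {x y : ℤ} :
    (chain a b p X).rel a x y ↔ (x + 1) / 2 = (y + 1) / 2 :=
  ⟨fun h => h.1 rfl, fun h => ⟨fun _ => h, fun h' => absurd h' hab, fun h' => absurd rfl h'⟩⟩

theorem chain_rel_right (hab : a ≠ b) {X : Set ℤ} {x y : ℤ} :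
    (chain a b p X).rel b x y ↔ x / 2 = y / 2 :=
  ⟨fun h => h.2.1 rfl,
    fun h => ⟨fun h' => absurd h'.symm hab, fun _ => h, fun _ h' => absurd rfl h'⟩⟩

theorem le_add_one_of_chain_rel {X : Set ℤ} {c : A} {x y : ℤ}
    (h : (chain a b p X).rel c x y) : y ≤ x + 1 := by
  obtain ⟨h₁, h₂, h₃⟩ := h
  by_cases ha : c = a
  · have := h₁ ha
    omega
  by_cases hb : c = b
  · have := h₂ hb
    omega
  have := h₃ ha hb
  omega

theorem chain_rel_reflect {X Y : Set ℤ} {c : A} {x y : ℤ} (h : (chain a b p X).rel c x y) :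
    (chain a b p Y).rel c (1 - x) (1 - y) := by
  obtain ⟨h₁, h₂, h₃⟩ := h
  refine ⟨fun ha => ?_, fun hb => ?_, fun ha hb => ?_⟩
  · have := h₁ ha
    omega
  · have := h₂ hb
    omega
  · have := h₃ ha hb
    omega

theorem chain_boundedBisim {X Y : Set ℤ} {n : ℤ} (hXY : ∀ x < n, x ∈ X ↔ x ∈ Y) {k : ℕ} {x : ℤ}
    (hx : x + k < n) : BoundedBisim (chain a b p X) (chain a b p Y) k x x := by
  induction k generalizing x with
  | zero => exact fun q => and_congr_right fun _ => hXY x (by omega)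
  | succ k ih =>
    refine ⟨fun q => and_congr_right fun _ => hXY x (by omega), fun c => ⟨fun y hy => ?_,
      fun y hy => ?_⟩⟩ <;>
    · have := le_add_one_of_chain_rel hy
      exact ⟨y, hy, ih (by omega)⟩

theorem chain_satEL_reflect {X : Set ℤ} (hX : ∀ x, x ∈ X ↔ 1 - x ∈ X) (χ : ELForm A P) (x : ℤ) :
    SatEL (chain a b p X) x χ ↔ SatEL (chain a b p X) (1 - x : ℤ) χ := by
  induction χ generalizing x with
  | atom q => exact and_congr_right fun _ => hX x
  | neg φ ih => exact not_congr (ih x)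
  | and φ ψ ihφ ihψ => exact and_congr (ihφ x) (ihψ x)
  | know c φ ih =>
    constructor
    · intro h (y : ℤ) hy
      have hy' := chain_rel_reflect (Y := X) hy
      rw [sub_sub_cancel] at hy'
      exact (ih y).2 (h _ hy')
    · intro h (y : ℤ) hy
      exact (ih y).2 (h _ (chain_rel_reflect hy))

/-- All states reachable in at most `k` steps along `a` and `b` satisfy `φ`. -/
def ELForm.within (a b : A) (φ : ELForm A P) : ℕ → ELForm A P
  | 0 => φ
  | k + 1 => .and (.know a (within a b φ k)) (.know b (within a b φ k))

theorem chain_satEL_within (hab : a ≠ b) {X : Set ℤ} (φ : ELForm A P) (k : ℕ) (x : ℤ) :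
    SatEL (chain a b p X) x (φ.within a b k) ↔
      ∀ y : ℤ, x - k ≤ y → y ≤ x + k → SatEL (chain a b p X) y φ := by
  induction k generalizing x with
  | zero =>
    refine ⟨fun h y h₁ h₂ => ?_, fun h => h x (by omega) (by omega)⟩
    obtain rfl : y = x := by omega
    exact h
  | succ k ih =>
    have key : SatEL (chain a b p X) x (φ.within a b (k + 1)) ↔
        ∀ y : ℤ, x - 1 ≤ y → y ≤ x + 1 → SatEL (chain a b p X) y (φ.within a b k) := by
      constructor
      · rintro ⟨ha, hb⟩ y h₁ h₂
        have hy : (x + 1) / 2 = (y + 1) / 2 ∨ x / 2 = y / 2 := by omega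
        exact hy.elim (fun hy => ha y ((chain_rel_left hab).2 hy))
          fun hy => hb y ((chain_rel_right hab).2 hy)
      · intro h
        refine ⟨fun (y : ℤ) hy => ?_, fun (y : ℤ) hy => ?_⟩
        · have := (chain_rel_left hab).1 hy
          exact h y (by omega) (by omega)
        · have := (chain_rel_right hab).1 hy
          exact h y (by omega) (by omega)
    rw [key]
    constructor
    · intro h z h₁ h₂
      push_cast at h₁ h₂
      rcases lt_trichotomy z x with hz | hz | hz
      · exact (ih (x - 1)).1 (h (x - 1) (by omega) (by omega)) z (by omega) (by omega)
      · exact (ih x).1 (h x (by omega) (by omega)) z (by omega) (by omega)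
      · exact (ih (x + 1)).1 (h (x + 1) (by omega) (by omega)) z (by omega) (by omega)
    · intro h y h₁ h₂
      exact (ih y).2 fun z h₃ h₄ => h z (by push_cast; omega) (by push_cast; omega)

theorem chain_satEL_near (hab : a ≠ b) {X : Set ℤ} (n : ℕ) (x : ℤ) :
    SatEL (chain a b p X) x
        (((((ELForm.atom p).neg).within a b n).neg).within a b n) ↔
      ∀ y : ℤ, x - n ≤ y → y ≤ x + n → ∃ z ∈ X, y - n ≤ z ∧ z ≤ y + n := by
  rw [chain_satEL_within hab]
  refine forall_congr' fun y => forall_congr' fun _ => forall_congr' fun _ => ?_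
  change ¬ SatEL (chain a b p X) y ((ELForm.atom p).neg.within a b n) ↔ _
  rw [chain_satEL_within hab]
  have hz : ∀ z : ℤ, SatEL (chain a b p X) z (ELForm.atom p).neg ↔ z ∉ X :=
    fun z => not_congr (and_iff_right rfl)
  simp only [hz]
  push Not
  exact exists_congr fun z => by tauto

/-- Some announcement makes `a` know `p` without `b` knowing this. -/
theorem satAPAL_dia_iff {M : Model A P} {s : M.S} :
    SatAPAL M s (Form.dia (.and (.know a (.atom p)) (.neg (.know b (.know a (.atom p)))))) ↔
      ∃ χ : ELForm A P, SatEL M s χ ∧ (∀ t, SatEL M t χ → M.rel a s t → M.val p t) ∧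
        ∃ t, SatEL M t χ ∧ M.rel b s t ∧ ∃ u, SatEL M u χ ∧ M.rel a t u ∧ ¬ M.val p u := by
  simp only [Form.dia, SatAPAL, Model.restrict, not_forall, not_not, exists_prop, Subtype.forall,
    Set.mem_ofPred_eq]

theorem chain_not_satAPAL (hab : a ≠ b) :
    ¬ SatAPAL (chain a b p {x | x = 0 ∨ x = 1}) (0 : ℤ)
      (Form.dia (.and (.know a (.atom p)) (.neg (.know b (.know a (.atom p)))))) := by
  rw [satAPAL_dia_iff]
  rintro ⟨χ, -, hK, t, -, hbt, u, hu, hau, hpu⟩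
  rw [chain_rel_right hab] at hbt
  rw [chain_rel_left hab] at hau
  change ℤ at t u
  replace hpu : ¬ (u = 0 ∨ u = 1) := fun h => hpu ⟨rfl, h⟩
  have hu' : (u = -1) ∨ (u = 2) := by omega
  have hneg : SatEL (chain a b p {x : ℤ | x = 0 ∨ x = 1}) (-1 : ℤ) χ := by
    rcases hu' with rfl | rfl
    · exact hu
    · exact (chain_satEL_reflect (fun x => by simp only [Set.mem_ofPred_eq]; omega) χ 2).1 hu
  have h := (hK (-1 : ℤ) hneg ((chain_rel_left hab).2 (by norm_num))).2
  simp only [Set.mem_ofPred_eq] at h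
  omega

theorem chain_satAPAL (hab : a ≠ b) {n : ℕ} (hn : 3 ≤ n) :
    SatAPAL (chain a b p {x | x = 0 ∨ x = 1 ∨ (n : ℤ) ≤ x}) (0 : ℤ)
      (Form.dia (.and (.know a (.atom p)) (.neg (.know b (.know a (.atom p)))))) := by
  rw [satAPAL_dia_iff]
  have hχ : ∀ x : ℤ, 0 ≤ x → SatEL (chain a b p {x | x = 0 ∨ x = 1 ∨ (n : ℤ) ≤ x}) x
      (((((ELForm.atom p).neg).within a b n).neg).within a b n) := by
    intro x hx
    rw [chain_satEL_near hab]
    intro y h₁ h₂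
    rcases le_total y n with hy | hy
    · exact ⟨0, Or.inl rfl, by omega, by omega⟩
    · exact ⟨y, Or.inr (Or.inr hy), by omega, by omega⟩
  refine ⟨_, hχ 0 le_rfl, fun (t : ℤ) ht hat => ?_, (1 : ℤ), hχ 1 (by norm_num),
    (chain_rel_right hab).2 (by norm_num), (2 : ℤ), hχ 2 (by norm_num),
    (chain_rel_left hab).2 (by norm_num), fun h => ?_⟩
  · rw [chain_rel_left hab] at hat
    have ht' : t = 0 ∨ t = -1 := by omega
    rcases ht' with rfl | rfl
    · exact ⟨rfl, Or.inl rfl⟩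
    · rw [chain_satEL_near hab] at ht
      obtain ⟨z, hz, h₁, h₂⟩ := ht (-1 - n) (by omega) (by omega)
      simp only [Set.mem_ofPred_eq] at hz
      omega
  · have := h.2
    simp only [Set.mem_ofPred_eq] at this
    omega

end Chain

/-- L_BAPAL is not at least as expressive as APAL: no L_BAPAL formula
(under BAPAL semantics) is true at exactly the same pointed epistemic models as
`◇(K_a p ∧ ¬K_b K_a p)` under APAL semantics (`◇χ := ¬□¬χ`), given agents `a ≠ b`. -/
theorem bapal_not_at_least_as_expressive_as_apal {A : Type} [Countable A]
    (a b : A) (hab : a ≠ b) (p : ℕ) :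
    ¬ ∃ ψ : Form A ℕ,
        ∀ M : Model A ℕ, M.IsEpistemic → ∀ s : M.S,
          (Sat M s ψ ↔
            SatAPAL M s (Form.dia (.and (.know a (.atom p))
              (.neg (.know b (.know a (.atom p))))))) := by
  rintro ⟨ψ, hψ⟩
  have hbisim : BoundedBisim (chain a b p {x | x = 0 ∨ x = 1})
      (chain a b p {x | x = 0 ∨ x = 1 ∨ ((ψ.depth + 3 : ℕ) : ℤ) ≤ x}) ψ.depth (0 : ℤ) (0 : ℤ) :=
    chain_boundedBisim (n := ((ψ.depth + 3 : ℕ) : ℤ))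
      (fun x hx => by simp only [Set.mem_ofPred_eq]; omega) (by push_cast; omega)
  exact chain_not_satAPAL hab ((hψ _ chain_isEpistemic _).1 ((hbisim.sat_iff ψ).2
    ((hψ _ chain_isEpistemic _).2 (chain_satAPAL hab (Nat.le_add_left 3 _)))))
end

section
/- For every formula φ in arbitrary announcement normal form, the cardinality of its closure satisfies |cl(φ)| ≤ |φ| · 4^{|φ|}, where |φ| is the number of symbols of φ. -/
/-- The language L_AANF: `φ ::= p | ¬φ | (φ∧φ) | K_a φ | [φ]□φ`. -/
inductive AForm (A : Type) : Type
  | atom : ℕ → AForm A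
  | neg : AForm A → AForm A
  | and : AForm A → AForm A → AForm A
  | know : A → AForm A → AForm A
  | annbox : AForm A → AForm A → AForm A   -- `[α]□ψ`

/-- Modal depth of an AANF formula. -/
def AForm.d {A : Type} : AForm A → ℕ
  | .atom _ => 0
  | .neg φ => φ.d
  | .and φ ψ => max φ.d ψ.d
  | .know _ φ => φ.d + 1
  | .annbox α ψ => max α.d ψ.d

/-- Number of symbols of an AANF formula. -/
def AForm.size {A : Type} : AForm A → ℕ
  | .atom _ => 1
  | .neg φ => φ.size + 1
  | .and φ ψ => φ.size + ψ.size + 1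
  | .know _ φ => φ.size + 1
  | .annbox α ψ => α.size + ψ.size + 2

/-- The set of subformulas of an AANF formula (with respect to the AANF grammar:
the subformulas of `[α]□ψ` include `α` and `ψ` but not `□ψ`). -/
def AForm.sub {A : Type} : AForm A → Set (AForm A)
  | .atom p => {.atom p}
  | .neg φ => insert (.neg φ) φ.sub
  | .and φ ψ => insert (.and φ ψ) (φ.sub ∪ ψ.sub)
  | .know a φ => insert (.know a φ) φ.sub
  | .annbox α ψ => insert (.annbox α ψ) (α.sub ∪ ψ.sub)

/-- Fuel-indexed closure; `clAux n φ` computes the closure of `φ` when `n ≥ d(φ)`. -/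
def clAux {A : Type} : ℕ → AForm A → Set (AForm A)
  | 0, φ => {χ | ∃ ψ ∈ φ.sub, χ = ψ ∨ χ = .neg ψ}
  | n+1, φ =>
      {χ | ∃ ψ ∈ φ.sub, χ = ψ ∨ χ = .neg ψ} ∪
      {χ | ∃ (a : A) (ψ : AForm A), AForm.know a ψ ∈ φ.sub ∧
            ∃ ψ' ∈ clAux n ψ, χ = .know a ψ' ∨ χ = .neg (.know a ψ')}

/-- The closure `cl(φ)` of an AANF formula: `cl(φ) = {ψ, ¬ψ : ψ ⊆ φ}` if `d(φ)=0`,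
and `cl(φ) = {ψ, ¬ψ : ψ ⊆ φ} ∪ {K_aψ', ¬K_aψ' : K_aψ ⊆ φ, ψ' ∈ cl(ψ)}` otherwise. -/
def cl {A : Type} (φ : AForm A) : Set (AForm A) := clAux φ.d φ

theorem encard_union_le_add {α : Type*} {s t : Set α} {k l : ℕ} (hs : s.encard ≤ k)
    (ht : t.encard ≤ l) : (s ∪ t).encard ≤ (k + l : ℕ) := by
  push_cast
  exact (Set.encard_union_le s t).trans (add_le_add hs ht)

theorem encard_pair_le_two {α : Type*} (a b : α) : ({a, b} : Set α).encard ≤ (2 : ℕ) := by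
  refine (Set.encard_insert_le {b} a).trans ?_
  rw [Set.encard_singleton]
  exact_mod_cast le_rfl

theorem clAux_atom_subset {A : Type} (n p : ℕ) :
    clAux n (.atom p : AForm A) ⊆ {.atom p, .neg (.atom p)} := by
  intro χ hχ
  cases n <;> simp_all [clAux, AForm.sub]

theorem clAux_neg_subset {A : Type} (n : ℕ) (φ : AForm A) :
    clAux n φ.neg ⊆ clAux n φ ∪ {φ.neg, φ.neg.neg} := by
  intro χ hχ
  cases n <;> simp only [clAux, AForm.sub, Set.mem_insert_iff, Set.mem_union, Set.mem_ofPred_eq,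
    Set.mem_singleton_iff] at hχ ⊢ <;> grind

theorem clAux_and_subset {A : Type} (n : ℕ) (φ ψ : AForm A) :
    clAux n (φ.and ψ) ⊆ clAux n φ ∪ clAux n ψ ∪ {φ.and ψ, (φ.and ψ).neg} := by
  intro χ hχ
  cases n <;> simp only [clAux, AForm.sub, Set.mem_insert_iff, Set.mem_union, Set.mem_ofPred_eq,
    Set.mem_singleton_iff] at hχ ⊢ <;> grind

theorem clAux_annbox_subset {A : Type} (n : ℕ) (φ ψ : AForm A) :
    clAux n (φ.annbox ψ) ⊆ clAux n φ ∪ clAux n ψ ∪ {φ.annbox ψ, (φ.annbox ψ).neg} := by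
  intro χ hχ
  cases n <;> simp only [clAux, AForm.sub, Set.mem_insert_iff, Set.mem_union, Set.mem_ofPred_eq,
    Set.mem_singleton_iff] at hχ ⊢ <;> grind

theorem clAux_zero_know_subset {A : Type} (a : A) (φ : AForm A) :
    clAux 0 (φ.know a) ⊆ clAux 0 φ ∪ {φ.know a, (φ.know a).neg} := by
  intro χ hχ
  simp only [clAux, AForm.sub, Set.mem_insert_iff, Set.mem_union, Set.mem_ofPred_eq,
    Set.mem_singleton_iff] at hχ ⊢
  grind

theorem clAux_succ_know_subset {A : Type} (n : ℕ) (a : A) (φ : AForm A) :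
    clAux (n + 1) (φ.know a) ⊆ clAux (n + 1) φ ∪ {φ.know a, (φ.know a).neg} ∪
      (AForm.know a '' clAux n φ ∪ (fun ψ => (AForm.know a ψ).neg) '' clAux n φ) := by
  intro χ hχ
  simp only [clAux, AForm.sub, Set.mem_insert_iff, Set.mem_union, Set.mem_ofPred_eq,
    Set.mem_singleton_iff, Set.mem_image, AForm.know.injEq] at hχ ⊢
  grind

/-- The cardinality bound holds for every amount of fuel, not only for the modal depth. -/
theorem encard_clAux_le {A : Type} (φ : AForm A) (n : ℕ) :
    (clAux n φ).encard ≤ (φ.size * 4 ^ φ.size : ℕ) := by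
  have binary (s t : ℕ) : s * 4 ^ s + t * 4 ^ t + 2 ≤ (s + t + 1) * 4 ^ (s + t + 1) := by
    have hs : 4 ^ s ≤ 4 ^ (s + t) := Nat.pow_le_pow_right (by norm_num) (by omega)
    have ht : 4 ^ t ≤ 4 ^ (s + t) := Nat.pow_le_pow_right (by norm_num) (by omega)
    have h1 : 1 ≤ 4 ^ (s + t) := Nat.one_le_pow _ _ (by norm_num)
    rw [pow_succ]
    nlinarith [Nat.mul_le_mul_left s hs, Nat.mul_le_mul_left t ht]
  have unary (s : ℕ) : s * 4 ^ s + 2 + (s * 4 ^ s + s * 4 ^ s) ≤ (s + 1) * 4 ^ (s + 1) := by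
    have h1 : 1 ≤ 4 ^ s := Nat.one_le_pow _ _ (by norm_num)
    rw [pow_succ]
    nlinarith
  induction φ generalizing n with
  | atom p =>
    refine (Set.encard_le_encard (clAux_atom_subset n p)).trans
      ((encard_pair_le_two _ _).trans ?_)
    simp only [AForm.size]
    exact_mod_cast (by norm_num : 2 ≤ 1 * 4 ^ 1)
  | neg φ ih =>
    refine (Set.encard_le_encard (clAux_neg_subset n φ)).trans
      ((encard_union_le_add (ih n) (encard_pair_le_two _ _)).trans ?_)
    have := unary φ.size
    exact Nat.cast_le.2 (by simp only [AForm.size]; omega)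
  | and φ ψ ihφ ihψ =>
    refine (Set.encard_le_encard (clAux_and_subset n φ ψ)).trans ((encard_union_le_add
      (encard_union_le_add (ihφ n) (ihψ n)) (encard_pair_le_two _ _)).trans ?_)
    exact Nat.cast_le.2 (binary φ.size ψ.size)
  | know a φ ih =>
    cases n with
    | zero =>
      refine (Set.encard_le_encard (clAux_zero_know_subset a φ)).trans
        ((encard_union_le_add (ih 0) (encard_pair_le_two _ _)).trans ?_)
      have := unary φ.size
      exact Nat.cast_le.2 (by simp only [AForm.size]; omega)
    | succ n =>
      refine (Set.encard_le_encard (clAux_succ_know_subset n a φ)).trans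
        ((encard_union_le_add (encard_union_le_add (ih (n + 1)) (encard_pair_le_two _ _))
          (encard_union_le_add ((Set.encard_image_le _ _).trans (ih n))
            ((Set.encard_image_le _ _).trans (ih n)))).trans ?_)
      exact Nat.cast_le.2 (unary φ.size)
  | annbox φ ψ ihφ ihψ =>
    refine (Set.encard_le_encard (clAux_annbox_subset n φ ψ)).trans ((encard_union_le_add
      (encard_union_le_add (ihφ n) (ihψ n)) (encard_pair_le_two _ _)).trans ?_)
    refine Nat.cast_le.2 ((binary φ.size ψ.size).trans ?_)
    simp only [AForm.size]
    gcongr <;> norm_num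

/-- for every AANF formula `φ`, the closure `cl(φ)` is finite with
cardinality at most `|φ| · 4^{|φ|}`. -/
theorem closure_size_bound {A : Type} [Countable A] (φ : AForm A) :
    (cl φ).Finite ∧ (cl φ).ncard ≤ φ.size * 4 ^ φ.size := by
  exact Set.encard_le_coe_iff_finite_ncard_le.1 (encard_clAux_le φ φ.d)
end
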